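/- Let w = −2(α₁ + α₂), let w₁, w₂ > 0 with w₀ := w − w₁ − h w₂ > 0, and let χ ∈ (0, 1/√(h|α₂|)). Set L = |α₂|·|α₁ + α₂|, H₁ = (w₁χ²/|α₂|)^{1/(μ−1)}, H₂ = (min{w₀/(hL), w₂/L})^{1/(μ−1)}, and let δ ∈ (0, min{H₁, H₂}). Define a₁ = 1 − χ²h|α₂|, b = max{1 + |α₂|h, (|α₂|(1 + |α₂|h)δ^{μ−1} + w₁ + h w₂)δ^{μ−1}}, c = min{w₀ − hLδ^{μ−1}, w₂ − Lδ^{μ−1}}, β = (2|α₂| + α₂²hδ^{μ−1} + w₁ + h w₂)·h, and let Δ > 0 be a root of Δ² + βΔ^{μ+1} = a₁δ². Set ĉ₁ = ((1 + βΔ^{μ−1})/a₁)^{1/2} and ĉ₂ = (c(μ−1)/b)·((1 + βΔ^{μ−1})/(2b(1+h)))^{(μ−1)/2}. If additionally a₁ > 0 (which holds since χ < 1/√(h|α₂|)), then every solution x of the scalar delay equation with initial function φ satisfying |φ|_h < Δ obeys |x(t)| ≤ ĉ₁|φ|_h·(1 + ĉ₂|φ|_h^{μ−1}·t)^{−1/(μ−1)}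 for all t ≥ 0. -/

import Mathlib

open Real Set

/-- The moving-window integral of `f` over `[t-h,t]`. -/
noncomputable def lkJ (h : ℝ) (f : ℝ → ℝ) (t : ℝ) : ℝ := ∫ s in (t-h)..t, f s

lemma lkJ_deriv (h : ℝ) (f : ℝ → ℝ) (hf : Continuous f) (t : ℝ) :
    HasDerivAt (lkJ h f) (f t - f (t-h)) t := by
  have e : lkJ h f = fun t => (∫ s in (0:ℝ)..t, f s) - ∫ s in (0:ℝ)..(t-h), f s := by
    funext t
    unfold lkJ
    rw [intervalIntegral.integral_interval_sub_left (hf.intervalIntegrable _ _)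
      (hf.intervalIntegrable _ _)]
  rw [e]
  have h1 : ∀ u, HasDerivAt (fun t => ∫ s in (0:ℝ)..t, f s) (f u) u := fun u =>
    intervalIntegral.integral_hasDerivAt_right (hf.intervalIntegrable _ _)
      (hf.stronglyMeasurableAtFilter _ _) hf.continuousAt
  have h2 : HasDerivAt (fun t => ∫ s in (0:ℝ)..(t-h), f s) (f (t-h)) t := by
    have := (h1 (t-h)).comp t ((hasDerivAt_id t).sub_const h)
    rw [mul_one] at this
    exact this
  exact (h1 t).sub h2

lemma lkJ_mono {h : ℝ} (hh : 0 < h) {f g : ℝ → ℝ} (hf : Continuous f) (hg : Continuous g) {t : ℝ}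
    (hfg : ∀ s ∈ Icc (t-h) t, f s ≤ g s) : lkJ h f t ≤ lkJ h g t := by
  unfold lkJ
  exact intervalIntegral.integral_mono_on (by linarith) (hf.intervalIntegrable _ _)
    (hg.intervalIntegrable _ _) hfg

lemma lkJ_add {h : ℝ} {f g : ℝ → ℝ} (hf : Continuous f) (hg : Continuous g) (t : ℝ) :
    lkJ h (fun s => f s + g s) t = lkJ h f t + lkJ h g t :=
  intervalIntegral.integral_add (hf.intervalIntegrable _ _) (hg.intervalIntegrable _ _)

lemma lkJ_smul {h : ℝ} (r : ℝ) (f : ℝ → ℝ) (t : ℝ) :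
    lkJ h (fun s => r * f s) t = r * lkJ h f t :=
  intervalIntegral.integral_const_mul _ _

lemma lkJ_const {h : ℝ} (r : ℝ) (t : ℝ) : lkJ h (fun _ => r) t = h * r := by
  simp [lkJ]

lemma lk_tangent (k : ℕ) (u l : ℝ) (hu : 0 ≤ u) (hl : 0 ≤ l) :
    (k+1) * l^k * u ≤ u^(k+1) + k * l^(k+1) := by
  induction k with
  | zero => simp
  | succ k ih =>
    have h1 := mul_le_mul_of_nonneg_right ih hu
    have h2 : 0 ≤ ((k:ℝ)+1) * l^k * (u-l)^2 := by positivity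
    push_cast
    have : u^(k+1+1) + (k+1) * l^(k+1+1) - ((k+1)+1) * l^(k+1) * u
      = (u^(k+1) + k*l^(k+1)) * u - (k+1)*l^k*u*u + ((k:ℝ)+1) * l^k * (u-l)^2 := by ring
    linarith

/-- Cauchy–Schwarz. -/
lemma lkJ_cs {h : ℝ} (hh : 0 < h) {f : ℝ → ℝ} (hf : Continuous f) (t : ℝ) :
    lkJ h f t ^ 2 ≤ h * lkJ h (fun s => f s ^ 2) t := by
  set l := lkJ h f t / h with hl
  have h1 : lkJ h (fun s => (2*l) * f s) t ≤ lkJ h (fun s => f s ^ 2 + l^2) t :=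
    lkJ_mono hh (by fun_prop) (by fun_prop) (fun s _ => by nlinarith [sq_nonneg (f s - l)])
  rw [lkJ_smul, lkJ_add (by fun_prop) (by fun_prop), lkJ_const] at h1
  have h2 : lkJ h f t = l * h := by rw [hl]; field_simp
  rw [h2] at h1 ⊢
  nlinarith

/-- Jensen for the measure `δ_t + Lebesgue`. -/
lemma lkJ_jensen {h : ℝ} (hh : 0 < h) {x : ℝ → ℝ} (hx : Continuous x) (t : ℝ) (k : ℕ) :
    (x t ^ 2 + lkJ h (fun s => x s ^ 2) t)^(k+1) ≤
      (1+h)^k * (x t ^ (2*k+2) + lkJ h (fun s => x s ^ (2*k+2)) t) := by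
  set A := x t ^ 2 + lkJ h (fun s => x s ^ 2) t with hA
  set l := A / (1+h) with hl
  have hJ0 : 0 ≤ lkJ h (fun s => x s ^ 2) t := by
    have := lkJ_mono (t := t) hh (f := fun _ => 0) (g := fun s => x s ^ 2) (by fun_prop)
      (by fun_prop) (fun s _ => by positivity)
    rwa [lkJ_const, mul_zero] at this
  have hA0 : 0 ≤ A := by positivity
  have hl0 : 0 ≤ l := by positivity
  have hp : ∀ s, ((k+1) * l^k) * x s ^ 2 ≤ x s ^ (2*k+2) + k * l^(k+1) := by
    intro s
    have := lk_tangent k (x s ^ 2) l (sq_nonneg _) hl0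
    rwa [← pow_mul, show 2*(k+1) = 2*k+2 by ring] at this
  have h1 : lkJ h (fun s => ((k+1) * l^k) * x s ^ 2) t ≤
      lkJ h (fun s => x s ^ (2*k+2) + k * l^(k+1)) t :=
    lkJ_mono hh (by fun_prop) (by fun_prop) (fun s _ => hp s)
  rw [lkJ_smul, lkJ_add (by fun_prop) (by fun_prop), lkJ_const] at h1
  have h2 := hp t
  have hAl : A = l * (1+h) := by rw [hl]; field_simp
  have h3 : (k+1)*l^k * A ≤ (x t ^ (2*k+2) + lkJ h (fun s => x s ^ (2*k+2)) t)
      + (1+h) * (k * l^(k+1)) := by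
    rw [hA]; linarith
  have h4 : (1+h) * l^(k+1) ≤ (x t ^ (2*k+2) + lkJ h (fun s => x s ^ (2*k+2)) t) := by
    rw [hAl] at h3
    have : (k+1)*l^k * (l*(1+h)) = (1+h) * (k * l^(k+1)) + (1+h)*l^(k+1) := by ring
    linarith
  calc A^(k+1) = (1+h)^k * ((1+h) * l^(k+1)) := by rw [hAl, mul_pow]; ring
    _ ≤ _ := by gcongr

/-- Comparison lemma. -/
lemma lk_compare (v v' : ℝ → ℝ) (k : ℕ) (K V T : ℝ) (hK : 0 ≤ K) (hT : 0 ≤ T)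
    (hvc : ContinuousOn v (Icc 0 T)) (hv0 : ∀ t ∈ Icc 0 T, 0 ≤ v t)
    (hvd : ∀ t ∈ Ioo 0 T, HasDerivAt v (v' t) t)
    (hv' : ∀ t ∈ Ioo 0 T, v' t ≤ - K * v t ^ (k+1)) (hV : v 0 ≤ V) (hk : k ≠ 0) :
    v T ^ k * (1 + k * K * V^k * T) ≤ V^k := by
  have anti : AntitoneOn v (Icc 0 T) := by
    apply antitoneOn_of_deriv_nonpos (convex_Icc _ _) hvc
    · rw [interior_Icc]
      exact fun t ht => (hvd t ht).differentiableAt.differentiableWithinAt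
    · rw [interior_Icc]
      intro t ht
      rw [(hvd t ht).deriv]
      have := hv' t ht
      have := mul_nonneg hK (pow_nonneg (hv0 t ⟨ht.1.le, ht.2.le⟩) (k+1))
      linarith
  have hTT : T ∈ Icc 0 T := ⟨hT, le_rfl⟩
  have h00 : (0:ℝ) ∈ Icc 0 T := ⟨le_rfl, hT⟩
  have hV0 : 0 ≤ V := (hv0 0 h00).trans hV
  rcases (hv0 T hTT).eq_or_lt with h0 | h0
  · rw [← h0, zero_pow hk, zero_mul]; positivity
  have pos : ∀ t ∈ Icc 0 T, 0 < v t := fun t ht => h0.trans_le (anti ht hTT ht.2)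
  have mono : MonotoneOn (fun t => (v t ^ k)⁻¹ - k * K * t) (Icc 0 T) := by
    have hd : ∀ t ∈ Ioo 0 T, HasDerivAt (fun t => (v t ^ k)⁻¹ - k * K * t)
        (-(k * v t ^ (k-1) * v' t) / (v t ^ k)^2 - k * K) t := by
      intro t ht
      have hp := pos t ⟨ht.1.le, ht.2.le⟩
      have := (((hvd t ht).pow k).inv (pow_ne_zero k hp.ne')).sub
        ((hasDerivAt_id t).const_mul (k*K))
      rw [mul_one] at this
      exact this
    apply monotoneOn_of_deriv_nonneg (convex_Icc _ _)
    · apply ContinuousOn.sub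
      · exact (hvc.pow k).inv₀ (fun t ht => pow_ne_zero k (pos t ht).ne')
      · fun_prop
    · rw [interior_Icc]
      exact fun t ht => (hd t ht).differentiableAt.differentiableWithinAt
    · rw [interior_Icc]
      intro t ht
      rw [(hd t ht).deriv, sub_nonneg]
      have hp := pos t ⟨ht.1.le, ht.2.le⟩
      rw [le_div_iff₀ (by positivity)]
      obtain ⟨j, rfl⟩ := Nat.exists_eq_succ_of_ne_zero hk
      have h1 := mul_le_mul_of_nonneg_left (hv' t ht)
        (show 0 ≤ ((j.succ : ℕ):ℝ) * v t ^ j by positivity)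
      simp only [Nat.succ_eq_add_one, Nat.add_sub_cancel] at h1 ⊢
      have e : ((j+1:ℕ):ℝ) * v t ^ j * (-K * v t ^ (j+1+1)) = - ((j+1:ℕ) * K * (v t ^ (j+1))^2) := by
        ring
      linarith
  have h1 := mono h00 hTT hT
  simp only [mul_zero, sub_zero] at h1
  have hv00 := pos 0 h00
  have hVp : 0 < V := hv00.trans_le hV
  have h2 : (V^k)⁻¹ ≤ (v 0 ^ k)⁻¹ := by gcongr
  have h3 : (V^k)⁻¹ + k*K*T ≤ (v T ^ k)⁻¹ := by linarith
  have h4 := mul_le_mul_of_nonneg_left h3 (show 0 ≤ v T ^ k * V^k by positivity)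
  have e1 : v T ^ k * V^k * ((V^k)⁻¹ + k*K*T) = v T ^ k * (1 + k * K * V^k * T) := by
    field_simp
  have e2 : v T ^ k * V^k * (v T ^ k)⁻¹ = V^k := by field_simp
  rwa [e1, e2] at h4

lemma lk_alg_lower (h a w₁ χ D X I1 Iq Ip W : ℝ) (hh : 0 < h) (hχ : 0 < χ)
    (h1 : I1^2 ≤ h * Iq) (h2 : Iq ≤ D * Ip) (hIp : 0 ≤ Ip) (hD : |a| * D ≤ w₁ * χ^2)
    (hW : w₁ * Ip ≤ W) : (1 - χ^2 * h * |a|) * X^2 ≤ (X + a * I1)^2 + W := by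
  have e : |a| * Iq ≤ χ^2 * W := by
    calc |a| * Iq ≤ |a| * (D * Ip) := by gcongr
      _ = (|a| * D) * Ip := by ring
      _ ≤ (w₁ * χ^2) * Ip := by gcongr
      _ = χ^2 * (w₁ * Ip) := by ring
      _ ≤ _ := by gcongr
  have e2 : |a| * I1^2 ≤ h * (χ^2 * W) := by
    calc |a| * I1^2 ≤ |a| * (h * Iq) := by gcongr
      _ = h * (|a| * Iq) := by ring
      _ ≤ _ := by gcongr
  have hc : 0 < h * χ^2 := by positivity
  have e3 : -(|a| * ((h*χ^2*X)^2 + I1^2)) ≤ (h * χ^2) * (2 * X * a * I1) := by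
    have q1 : 0 ≤ (|a| + a) * (h*χ^2*X + I1)^2 := by
      have := neg_abs_le a
      exact mul_nonneg (by linarith) (sq_nonneg _)
    have q2 : 0 ≤ (|a| - a) * (h*χ^2*X - I1)^2 := by
      have := le_abs_self a
      exact mul_nonneg (by linarith) (sq_nonneg _)
    nlinarith
  have e4 : 0 ≤ (h * χ^2) * ((X + a * I1)^2 + W - (1 - χ^2 * h * |a|) * X^2) := by
    have : 0 ≤ (h*χ^2) * (a*I1)^2 := by positivity
    nlinarith
  have := nonneg_of_mul_nonneg_right e4 hc
  linarith

lemma lk_alg_upper (h a w₁ w₂ D X I1 Iq Ip I2 W b : ℝ) (hh : 0 < h) (hw₁ : 0 < w₁) (hw₂ : 0 < w₂)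
    (hD : 0 ≤ D) (h1 : I1^2 ≤ h * Iq) (h2 : Iq ≤ D * Ip) (h3 : Ip ≤ D * I2) (hI2 : 0 ≤ I2)
    (hW : W ≤ (w₁ + h * w₂) * Ip) (hb1 : 1 + |a| * h ≤ b)
    (hb2 : (|a| * (1 + |a| * h) * D + w₁ + h * w₂) * D ≤ b) :
    (X + a * I1)^2 + W ≤ b * (X^2 + I2) := by
  have e3 : h * (2 * X * a * I1) ≤ |a| * ((h*X)^2 + I1^2) := by
    have q1 : 0 ≤ (|a| + a) * (h*X - I1)^2 := by
      have := neg_abs_le a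
      exact mul_nonneg (by linarith) (sq_nonneg _)
    have q2 : 0 ≤ (|a| - a) * (h*X + I1)^2 := by
      have := le_abs_self a
      exact mul_nonneg (by linarith) (sq_nonneg _)
    nlinarith
  have e4 : |a| * I1^2 ≤ |a| * (h * Iq) := by gcongr
  have e5 : 2 * X * a * I1 ≤ |a| * (h * X^2 + Iq) := by
    have : h * (2 * X * a * I1) ≤ h * (|a| * (h * X^2 + Iq)) := by nlinarith
    exact le_of_mul_le_mul_left this hh
  have e6 : (a*I1)^2 ≤ |a|^2 * (h * Iq) := by
    rw [mul_pow, ← sq_abs a]; gcongr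
  have e7 : (X + a * I1)^2 ≤ (1 + |a| * h) * X^2 + |a| * (1 + |a| * h) * Iq := by nlinarith
  have e8 : |a| * (1 + |a| * h) * Iq ≤ |a| * (1 + |a| * h) * (D * Ip) := by gcongr
  have e9 : (|a| * (1 + |a| * h) * D + w₁ + h * w₂) * Ip ≤
      (|a| * (1 + |a| * h) * D + w₁ + h * w₂) * (D * I2) := by gcongr
  have e10 : ((|a| * (1 + |a| * h) * D + w₁ + h * w₂) * D) * I2 ≤ b * I2 := by gcongr
  have e11 : (1 + |a| * h) * X^2 ≤ b * X^2 := by gcongr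
  nlinarith

lemma lk_alg_deriv (h a₁ a w₀ w₁ w₂ D Y P Ph I1 Iq Ip X c : ℝ) (hh : 0 < h)
    (_hstab : a₁ + a < 0) (hw₁ : 0 < w₁)
    (hw₀ : w₀ = -2 * (a₁ + a) - w₁ - h * w₂) (hXY : X * Y = P) (hYP : Y^2 ≤ D * P)
    (h1 : I1^2 ≤ h * Iq) (h2 : Iq ≤ D * Ip) (hP : 0 ≤ P) (hPh : 0 ≤ Ph) (hIp : 0 ≤ Ip)
    (hc1 : c ≤ w₀ - h * (|a| * |a₁ + a|) * D) (hc2 : c ≤ w₂ - (|a| * |a₁ + a|) * D) :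
    2 * (X + a * I1) * ((a₁ + a) * Y) + ((w₁ + h * w₂) * P - w₁ * Ph - w₂ * Ip) ≤
      - c * (P + Ip) := by
  set s := a * (a₁ + a) with hs
  have hL : |a| * |a₁ + a| = |s| := (abs_mul _ _).symm
  rw [hL] at hc1 hc2
  have e3 : h * (2 * s * Y * I1) ≤ |s| * ((h*Y)^2 + I1^2) := by
    have q1 : 0 ≤ (|s| + s) * (h*Y - I1)^2 := by
      have := neg_abs_le s
      exact mul_nonneg (by linarith) (sq_nonneg _)
    have q2 : 0 ≤ (|s| - s) * (h*Y + I1)^2 := by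
      have := le_abs_self s
      exact mul_nonneg (by linarith) (sq_nonneg _)
    nlinarith
  have e4 : |s| * I1^2 ≤ |s| * (h * Iq) := by gcongr
  have e5 : 2 * s * Y * I1 ≤ |s| * (h * Y^2 + Iq) := by
    have : h * (2 * s * Y * I1) ≤ h * (|s| * (h * Y^2 + Iq)) := by nlinarith
    exact le_of_mul_le_mul_left this hh
  have e6 : |s| * (h * Y^2 + Iq) ≤ |s| * (h * (D * P) + D * Ip) := by gcongr
  have e7 := mul_le_mul_of_nonneg_right hc1 hP
  have e8 := mul_le_mul_of_nonneg_right hc2 hIp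
  have e9 : 0 ≤ w₁ * Ph := by positivity
  have e10 : 2 * (X + a * I1) * ((a₁ + a) * Y) = 2 * (a₁+a) * (X*Y) + 2 * s * Y * I1 := by
    rw [hs]; ring
  rw [e10, hXY]
  have : w₀ * P = (-2 * (a₁ + a) - w₁ - h * w₂) * P := by rw [hw₀]
  linarith

/-- The Lyapunov–Krasovskii functional along `x`. -/
noncomputable def lkV (h a w₁ w₂ : ℝ) (k : ℕ) (x : ℝ → ℝ) (t : ℝ) : ℝ :=
  (x t + a * lkJ h (fun s => x s ^ (2*k+1)) t)^2 +
    ((w₁ + (h - t) * w₂) * lkJ h (fun s => x s ^ (2*k+2)) t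
      + w₂ * lkJ h (fun s => s * x s ^ (2*k+2)) t)

lemma lkV_deriv (h a₁ a w₁ w₂ : ℝ) (k : ℕ) (x : ℝ → ℝ) (hx : Continuous x) (t : ℝ)
    (hd : HasDerivAt x (a₁ * x t ^ (2*k+1) + a * x (t-h) ^ (2*k+1)) t) :
    HasDerivAt (lkV h a w₁ w₂ k x)
      (2 * (x t + a * lkJ h (fun s => x s ^ (2*k+1)) t) * ((a₁ + a) * x t ^ (2*k+1)) +
      ((w₁ + h * w₂) * x t ^ (2*k+2) - w₁ * x (t-h) ^ (2*k+2)
        - w₂ * lkJ h (fun s => x s ^ (2*k+2)) t)) t := by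
  have d1 := lkJ_deriv h (fun s => x s ^ (2*k+1)) (by fun_prop) t
  have d2 := lkJ_deriv h (fun s => x s ^ (2*k+2)) (by fun_prop) t
  have d3 := lkJ_deriv h (fun s => s * x s ^ (2*k+2)) (by fun_prop) t
  have d4 : HasDerivAt (fun t : ℝ => w₁ + (h - t) * w₂) (-1 * w₂) t :=
    (((hasDerivAt_id t).const_sub h).mul_const w₂).const_add w₁
  have d5 := ((hd.add (d1.const_mul a)).pow 2).add ((d4.mul d2).add (d3.const_mul w₂))
  have d6 : HasDerivAt (lkV h a w₁ w₂ k x) _ t := d5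
  refine d6.congr_deriv ?_
  simp
  ring

lemma lk_bounds {h : ℝ} (hh : 0 < h) {δ : ℝ} {k : ℕ} {x : ℝ → ℝ} (hx : Continuous x)
    {t : ℝ} (hb : ∀ s ∈ Icc (t-h) t, |x s| ≤ δ) {w₁ w₂ : ℝ} (hw₂ : 0 < w₂) :
    lkJ h (fun s => x s ^ (2*k+1)) t ^ 2 ≤ h * lkJ h (fun s => (x s ^ (2*k+1))^2) t ∧
    lkJ h (fun s => (x s ^ (2*k+1))^2) t ≤ δ^(2*k) * lkJ h (fun s => x s ^ (2*k+2)) t ∧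
    lkJ h (fun s => x s ^ (2*k+2)) t ≤ δ^(2*k) * lkJ h (fun s => x s ^ 2) t ∧
    0 ≤ lkJ h (fun s => x s ^ (2*k+2)) t ∧ 0 ≤ lkJ h (fun s => x s ^ 2) t ∧
    w₁ * lkJ h (fun s => x s ^ (2*k+2)) t ≤ (w₁ + (h - t) * w₂) * lkJ h (fun s => x s ^ (2*k+2)) t
      + w₂ * lkJ h (fun s => s * x s ^ (2*k+2)) t ∧
    (w₁ + (h - t) * w₂) * lkJ h (fun s => x s ^ (2*k+2)) t
      + w₂ * lkJ h (fun s => s * x s ^ (2*k+2)) t ≤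
      (w₁ + h * w₂) * lkJ h (fun s => x s ^ (2*k+2)) t ∧
    (∀ s ∈ Icc (t-h) t, (x s ^ (2*k+1))^2 ≤ δ^(2*k) * x s ^ (2*k+2)) := by
  have ev : ∀ s, 0 ≤ x s ^ (2*k+2) := fun s => by
    rw [show 2*k+2 = 2*(k+1) by ring, pow_mul]; positivity
  have pw : ∀ s ∈ Icc (t-h) t, x s ^ (2*k) ≤ δ^(2*k) := fun s hs => by
    have := pow_le_pow_left₀ (abs_nonneg _) (hb s hs) (2*k)
    rwa [Even.pow_abs (even_two_mul k)] at this
  have p1 : ∀ s ∈ Icc (t-h) t, (x s ^ (2*k+1))^2 ≤ δ^(2*k) * x s ^ (2*k+2) := fun s hs => by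
    calc (x s ^ (2*k+1))^2 = x s ^ (2*k) * x s ^ (2*k+2) := by ring
      _ ≤ _ := mul_le_mul_of_nonneg_right (pw s hs) (ev s)
  have nonneg : ∀ f : ℝ → ℝ, Continuous f → (∀ s, 0 ≤ f s) → 0 ≤ lkJ h f t := fun f hf h0 => by
    have := lkJ_mono (t := t) hh (f := fun _ => 0) (g := f) (by fun_prop) hf (fun s _ => h0 s)
    rwa [lkJ_const, mul_zero] at this
  have m1 : (t-h) * lkJ h (fun s => x s ^ (2*k+2)) t ≤ lkJ h (fun s => s * x s ^ (2*k+2)) t := by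
    rw [← lkJ_smul]
    exact lkJ_mono hh (by fun_prop) (by fun_prop)
      (fun s hs => mul_le_mul_of_nonneg_right hs.1 (ev s))
  have m2 : lkJ h (fun s => s * x s ^ (2*k+2)) t ≤ t * lkJ h (fun s => x s ^ (2*k+2)) t := by
    rw [← lkJ_smul]
    exact lkJ_mono hh (by fun_prop) (by fun_prop)
      (fun s hs => mul_le_mul_of_nonneg_right hs.2 (ev s))
  refine ⟨lkJ_cs hh (by fun_prop) t, ?_, ?_, nonneg _ (by fun_prop) ev,
    nonneg _ (by fun_prop) (fun s => sq_nonneg _), ?_, ?_, p1⟩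
  · rw [← lkJ_smul]
    exact lkJ_mono hh (by fun_prop) (by fun_prop) p1
  · rw [← lkJ_smul]
    refine lkJ_mono hh (by fun_prop) (by fun_prop) (fun s hs => ?_)
    rw [pow_add]
    exact mul_le_mul_of_nonneg_right (pw s hs) (sq_nonneg _)
  · have := mul_le_mul_of_nonneg_left m1 hw₂.le
    linarith
  · have := mul_le_mul_of_nonneg_left m2 hw₂.le
    linarith

/-- Upper bound of the functional at time `0`. -/
lemma lkV_start {h : ℝ} (hh : 0 < h) {δ N a w₁ w₂ : ℝ} {k : ℕ} {x : ℝ → ℝ} (hx : Continuous x)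
    (hw₁ : 0 < w₁) (hw₂ : 0 < w₂) (hN0 : 0 ≤ N) (hNδ : N ≤ δ)
    (hb : ∀ s ∈ Icc (-h) 0, |x s| ≤ N) :
    lkV h a w₁ w₂ k x 0 ≤
      N^2 + ((2 * |a| + a ^ 2 * h * δ ^ (2*k) + w₁ + h * w₂) * h) * N^(2*k+2) := by
  have hb' : ∀ s ∈ Icc (0-h) 0, |x s| ≤ N := by simpa using hb
  obtain ⟨-, -, -, -, -, -, hW, -⟩ := lk_bounds (k := k) (w₁ := w₁) hh hx hb' hw₂
  have hIp : lkJ h (fun s => x s ^ (2*k+2)) 0 ≤ h * N^(2*k+2) := by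
    rw [← lkJ_const (N^(2*k+2)) 0]
    refine lkJ_mono hh (by fun_prop) (by fun_prop) (fun s hs => ?_)
    refine (le_abs_self _).trans ?_
    rw [abs_pow]
    exact pow_le_pow_left₀ (abs_nonneg _) (hb' s hs) _
  have hI1 : |lkJ h (fun s => x s ^ (2*k+1)) 0| ≤ h * N^(2*k+1) := by
    rw [abs_le]
    constructor
    · rw [← mul_neg, ← lkJ_const (-N^(2*k+1)) 0]
      refine lkJ_mono hh (by fun_prop) (by fun_prop) (fun s hs => ?_)
      have := pow_le_pow_left₀ (abs_nonneg _) (hb' s hs) (2*k+1)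
      rw [← abs_pow] at this
      linarith [neg_abs_le (x s ^ (2*k+1))]
    · rw [← lkJ_const (N^(2*k+1)) 0]
      refine lkJ_mono hh (by fun_prop) (by fun_prop) (fun s hs => ?_)
      have := pow_le_pow_left₀ (abs_nonneg _) (hb' s hs) (2*k+1)
      rw [← abs_pow] at this
      linarith [le_abs_self (x s ^ (2*k+1))]
  have hz : |x 0 + a * lkJ h (fun s => x s ^ (2*k+1)) 0| ≤ N + |a| * (h * N^(2*k+1)) := by
    refine (abs_add_le _ _).trans ?_
    rw [abs_mul]
    gcongr
    exact hb 0 ⟨by linarith, le_rfl⟩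
  have hz2 := pow_le_pow_left₀ (abs_nonneg _) hz 2
  rw [sq_abs] at hz2
  have hW2 := hW.trans (mul_le_mul_of_nonneg_left hIp (show 0 ≤ w₁ + h * w₂ by positivity))
  have hpow : N^(2*k) ≤ δ^(2*k) := by gcongr
  have h5 : a^2*h^2*N^(2*k+2) * N^(2*k) ≤ a^2*h^2*N^(2*k+2) * δ^(2*k) := by gcongr
  have h6 : (N + |a| * (h * N^(2*k+1)))^2 =
      N^2 + 2 * |a| * h * N^(2*k+2) + a^2*h^2*N^(2*k+2) * N^(2*k) := by
    rw [← sq_abs a]; ring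
  unfold lkV
  have h7 : N^2 + ((2 * |a| + a ^ 2 * h * δ ^ (2*k) + w₁ + h * w₂) * h) * N^(2*k+2) =
      N^2 + 2 * |a| * h * N^(2*k+2) + a^2*h^2*N^(2*k+2) * δ^(2*k) +
        (w₁ + h * w₂) * (h * N^(2*k+2)) := by ring
  rw [h7]
  linarith

lemma lk_core {h : ℝ} (hh : 0 < h) {δ N a₁ a w₀ w₁ w₂ χ b c A V : ℝ} {k : ℕ} (hk : k ≠ 0)
    {x : ℝ → ℝ} (hx : Continuous x) (hstab : a₁ + a < 0)
    (hd : ∀ t > 0, HasDerivAt x (a₁ * x t ^ (2*k+1) + a * x (t-h) ^ (2*k+1)) t)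
    (hw₁ : 0 < w₁) (hw₂ : 0 < w₂) (hw₀ : w₀ = -2 * (a₁ + a) - w₁ - h * w₂) (hχ : 0 < χ)
    (hN0 : 0 ≤ N) (hNδ : N < δ) (hb : ∀ s ∈ Icc (-h) 0, |x s| ≤ N)
    (hD : |a| * δ^(2*k) ≤ w₁ * χ^2) (hb1 : 1 + |a| * h ≤ b)
    (hb2 : (|a| * (1 + |a| * h) * δ^(2*k) + w₁ + h * w₂) * δ^(2*k) ≤ b)
    (hc0 : 0 < c)
    (hc1 : c ≤ w₀ - h * (|a| * |a₁ + a|) * δ^(2*k)) (hc2 : c ≤ w₂ - (|a| * |a₁ + a|) * δ^(2*k))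
    (hA : A = 1 - χ^2 * h * |a|) (hApos : 0 < A)
    (hV1 : lkV h a w₁ w₂ k x 0 < A * δ^2) (hV : lkV h a w₁ w₂ k x 0 ≤ V) :
    ∀ T ≥ 0, (A * x T ^ 2)^k * (1 + k * (c / (b^(k+1) * (1+h)^k)) * V^k * T) ≤ V^k := by
  have hδ0 : 0 < δ := hN0.trans_lt hNδ
  have hbpos : 0 < b := by
    have : 0 ≤ |a| * h := by positivity
    linarith
  set K := c / (b^(k+1) * (1+h)^k) with hK
  have hK0 : 0 ≤ K := by positivity
  set v := lkV h a w₁ w₂ k x with hv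
  set v' : ℝ → ℝ := fun t =>
      (2 * (x t + a * lkJ h (fun s => x s ^ (2*k+1)) t) * ((a₁ + a) * x t ^ (2*k+1)) +
      ((w₁ + h * w₂) * x t ^ (2*k+2) - w₁ * x (t-h) ^ (2*k+2)
        - w₂ * lkJ h (fun s => x s ^ (2*k+2)) t)) with hv'
  have hvd : ∀ t > 0, HasDerivAt v (v' t) t := fun t ht =>
    lkV_deriv h a₁ a w₁ w₂ k x hx t (hd t ht)
  have hJc : ∀ f : ℝ → ℝ, Continuous f → Continuous (lkJ h f) := fun f hf =>
    continuous_iff_continuousAt.2 fun t => (lkJ_deriv h f hf t).continuousAt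
  have hvc : Continuous v := by
    have q1 := hJc (fun s => x s ^ (2*k+1)) (by fun_prop)
    have q2 := hJc (fun s => x s ^ (2*k+2)) (by fun_prop)
    have q3 := hJc (fun s => s * x s ^ (2*k+2)) (by fun_prop)
    rw [hv]
    unfold lkV
    fun_prop
  have hlow : ∀ t, (∀ s ∈ Icc (t-h) t, |x s| ≤ δ) → A * x t ^ 2 ≤ v t := by
    intro t ht
    obtain ⟨g1, g2, g3, g4, g5, g6, g7, g8⟩ := lk_bounds (k := k) (w₁ := w₁) hh hx ht hw₂
    rw [hA]
    exact lk_alg_lower h a w₁ χ _ _ _ _ _ _ hh hχ g1 g2 g4 hD g6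
  have hder : ∀ t, (∀ s ∈ Icc (t-h) t, |x s| ≤ δ) → v' t ≤ -K * v t ^ (k+1) := by
    intro t ht
    have hvt : 0 ≤ v t := le_trans (by positivity) (hlow t ht)
    obtain ⟨g1, g2, g3, g4, g5, g6, g7, g8⟩ := lk_bounds (k := k) (w₁ := w₁) hh hx ht hw₂
    have ev : ∀ s, 0 ≤ x s ^ (2*k+2) := fun s => by
      rw [show 2*k+2 = 2*(k+1) by ring, pow_mul]; positivity
    have u1 : v' t ≤ -c * (x t ^ (2*k+2) + lkJ h (fun s => x s ^ (2*k+2)) t) :=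
      lk_alg_deriv h a₁ a w₀ w₁ w₂ (δ^(2*k)) (x t ^ (2*k+1)) (x t ^ (2*k+2)) _ _ _ _ (x t) c hh
        hstab hw₁ hw₀ (by ring) (g8 t ⟨by linarith, le_rfl⟩) g1 g2 (ev t) (ev _) g4 hc1 hc2
    have u2 : v t ≤ b * (x t ^ 2 + lkJ h (fun s => x s ^ 2) t) :=
      lk_alg_upper h a w₁ w₂ (δ^(2*k)) _ _ _ _ _ _ b hh hw₁ hw₂ (by positivity) g1 g2 g3 g5 g7
        hb1 hb2
    have u3 := pow_le_pow_left₀ hvt u2 (k+1)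
    rw [mul_pow] at u3
    have u4 := lkJ_jensen hh hx t k
    have u5 := u3.trans (mul_le_mul_of_nonneg_left u4 (show 0 ≤ b^(k+1) by positivity))
    have u6 := mul_le_mul_of_nonneg_left u5 hK0
    have u7 : K * (b^(k+1) * ((1+h)^k *
        (x t ^ (2*k+2) + lkJ h (fun s => x s ^ (2*k+2)) t))) =
        c * (x t ^ (2*k+2) + lkJ h (fun s => x s ^ (2*k+2)) t) := by
      rw [hK]; field_simp
    rw [u7] at u6
    linarith
  have main : ∀ T ≥ 0, (∀ s ∈ Icc (-h) T, |x s| ≤ δ) → v T ≤ v 0 ∧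
      v T ^ k * (1 + k * K * V^k * T) ≤ V^k := by
    intro T hT hs
    have hw : ∀ t ∈ Icc 0 T, ∀ s ∈ Icc (t-h) t, |x s| ≤ δ := fun t ht s hs' =>
      hs s ⟨by linarith [hs'.1, ht.1], hs'.2.trans ht.2⟩
    have hv0 : ∀ t ∈ Icc 0 T, 0 ≤ v t := fun t ht =>
      le_trans (by positivity) (hlow t (hw t ht))
    refine ⟨?_, lk_compare v v' k K V T hK0 hT hvc.continuousOn hv0 (fun t ht => hvd t ht.1)
      (fun t ht => hder t (hw t ⟨ht.1.le, ht.2.le⟩)) hV hk⟩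
    have anti : AntitoneOn v (Icc 0 T) := by
      apply antitoneOn_of_deriv_nonpos (convex_Icc _ _) hvc.continuousOn
      · rw [interior_Icc]
        exact fun t ht => (hvd t ht.1).differentiableAt.differentiableWithinAt
      · rw [interior_Icc]
        intro t ht
        have ht' : t ∈ Icc 0 T := ⟨ht.1.le, ht.2.le⟩
        rw [(hvd t ht.1).deriv]
        have := hder t (hw t ht')
        have := mul_nonneg hK0 (pow_nonneg (hv0 t ht') (k+1))
        linarith
    exact anti ⟨le_rfl, hT⟩ ⟨hT, le_rfl⟩ hT
  have trap : ∀ t ≥ 0, |x t| < δ := by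
    by_contra! hcon
    obtain ⟨t, ht0, htd⟩ := hcon
    have hcpt : IsCompact (Icc 0 t ∩ {s | δ ≤ |x s|}) :=
      isCompact_Icc.inter_right (isClosed_le continuous_const hx.abs)
    obtain ⟨T, ⟨hT1, hT2⟩, hT3⟩ := hcpt.exists_isLeast ⟨t, ⟨ht0, le_rfl⟩, htd⟩
    have before : ∀ s ∈ Ico (-h) T, |x s| ≤ δ := by
      intro s hs
      rcases le_or_gt s 0 with h0 | h0
      · exact (hb s ⟨hs.1, h0⟩).trans hNδ.le
      · by_contra! hc
        have := hT3 ⟨⟨h0.le, hs.2.le.trans hT1.2⟩, hc.le⟩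
        linarith [hs.2]
    have upto : ∀ s ∈ Icc (-h) T, |x s| ≤ δ := by
      have hcl : IsClosed {s | |x s| ≤ δ} := isClosed_le hx.abs continuous_const
      have := closure_minimal (show Ico (-h) T ⊆ {s | |x s| ≤ δ} from before) hcl
      rw [closure_Ico (by linarith [hT1.1])] at this
      exact this
    have q1 := (main T hT1.1 upto).1
    have q2 := hlow T (fun s hs => upto s ⟨by linarith [hs.1, hT1.1], hs.2⟩)
    have q3 : δ^2 ≤ x T ^ 2 := by
      rw [← sq_abs (x T)]
      exact pow_le_pow_left₀ hδ0.le hT2 2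
    have q4 := mul_le_mul_of_nonneg_left q3 hApos.le
    linarith
  have all : ∀ s ≥ -h, |x s| ≤ δ := fun s hs => by
    rcases le_or_gt s 0 with h0 | h0
    · exact (hb s ⟨hs, h0⟩).trans hNδ.le
    · exact (trap s h0.le).le
  intro T hT
  have q1 := (main T hT (fun s hs => all s hs.1)).2
  have q2 := hlow T (fun s hs => all s (by linarith [hs.1]))
  have hV0 : 0 ≤ V := by
    refine le_trans ?_ ((hlow 0 (fun s hs => all s (by linarith [hs.1]))).trans hV)
    positivity
  refine le_trans ?_ q1
  gcongr

lemma lk_root {δ B : ℝ} {k : ℕ} (hk : k ≠ 0) (hδ : 0 < δ) (hB : 0 ≤ B)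
    (hlt : δ < B ^ (1 / (2 * (k:ℝ)))) : δ^(2*k) < B := by
  have h1 := pow_lt_pow_left₀ hlt hδ.le (show 2*k ≠ 0 by omega)
  rw [← Real.rpow_natCast (B ^ _), ← Real.rpow_mul hB] at h1
  have : (1 / (2 * (k:ℝ))) * ((2*k : ℕ):ℝ) = 1 := by
    have : (k:ℝ) ≠ 0 := by exact_mod_cast hk
    push_cast; field_simp
  rwa [this, Real.rpow_one] at h1

/-- Krasovskii-based estimate of the solutions of the scalar equation
`ẋ(t) = α₁x^μ(t) + α₂x^μ(t-h)` (Theorem 6). -/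
theorem solution_estimate_LK_scalar
    (h : ℝ) (hh : 0 < h) (μ : ℕ) (hμodd : Odd μ) (hμ : 1 < μ)
    (α₁ α₂ : ℝ) (hstab : α₁ + α₂ < 0)
    (w w₀ w₁ w₂ χ L H₁ H₂ δ a₁ b c β Δ c₁ c₂ : ℝ)
    (hw : w = -2 * (α₁ + α₂))
    (hw₁ : 0 < w₁) (hw₂ : 0 < w₂)
    (hw₀ : w₀ = w - w₁ - h * w₂) (hw₀pos : 0 < w₀)
    (hχ : χ ∈ Set.Ioo 0 (1 / Real.sqrt (h * |α₂|)))
    (hL : L = |α₂| * |α₁ + α₂|)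
    (hH₁ : H₁ = (w₁ * χ ^ 2 / |α₂|) ^ (1 / ((μ:ℝ) - 1)))
    (hH₂ : H₂ = (min (w₀ / (h * L)) (w₂ / L)) ^ (1 / ((μ:ℝ) - 1)))
    (hδ : δ ∈ Set.Ioo 0 (min H₁ H₂))
    (ha₁ : a₁ = 1 - χ ^ 2 * h * |α₂|)
    (hb : b = max (1 + |α₂| * h)
      ((|α₂| * (1 + |α₂| * h) * δ ^ (μ - 1) + w₁ + h * w₂) * δ ^ (μ - 1)))
    (hc : c = min (w₀ - h * L * δ ^ (μ - 1)) (w₂ - L * δ ^ (μ - 1)))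
    (hβ : β = (2 * |α₂| + α₂ ^ 2 * h * δ ^ (μ - 1) + w₁ + h * w₂) * h)
    (hΔpos : 0 < Δ) (hΔ : Δ ^ 2 + β * Δ ^ (μ + 1) = a₁ * δ ^ 2)
    (hc₁ : c₁ = ((1 + β * Δ ^ (μ - 1)) / a₁) ^ ((1:ℝ) / 2))
    (hc₂ : c₂ = (c * ((μ:ℝ) - 1) / b) *
      ((1 + β * Δ ^ (μ - 1)) / (2 * b * (1 + h))) ^ (((μ:ℝ) - 1) / 2))
    (ha₁pos : 0 < a₁)
    (φ x : ℝ → ℝ) (N : ℝ)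
    (hφc : ContinuousOn φ (Set.Icc (-h) 0))
    (hxc : ContinuousOn x (Set.Ici (-h)))
    (hxφ : ∀ θ ∈ Set.Icc (-h) (0:ℝ), x θ = φ θ)
    (hxd : ∀ t > (0:ℝ), HasDerivAt x (α₁ * x t ^ μ + α₂ * x (t - h) ^ μ) t)
    (hN : N = ⨆ θ : Set.Icc (-h) (0:ℝ), |φ θ.1|)
    (hφΔ : N < Δ) :
    ∀ t ≥ (0:ℝ), |x t| ≤ c₁ * N * (1 + c₂ * N ^ (μ - 1) * t) ^ (-(1 / ((μ:ℝ) - 1))) := by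
  obtain ⟨k, rfl⟩ := hμodd
  have hk : k ≠ 0 := by omega
  have hkR : (k:ℝ) ≠ 0 := by exact_mod_cast hk
  have hkp : (0:ℝ) < k := by positivity
  have hcast : ((2*k+1 : ℕ):ℝ) - 1 = 2 * k := by push_cast; ring
  have hsub : 2*k+1-1 = 2*k := by omega
  rw [hcast] at hH₁ hH₂ hc₂ ⊢
  rw [hsub] at hb hc hβ hc₁ hc₂ ⊢
  have hα : 0 < |α₂| := by
    rw [abs_pos]
    rintro rfl
    have h1 := hχ.1
    have h2 := hχ.2
    simp at h2
    linarith
  have hχ0 := hχ.1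
  have hδ0 := hδ.1
  have hLpos : 0 < L := by
    rw [hL]; exact mul_pos hα (abs_pos.2 hstab.ne)
  have hD1 : δ^(2*k) < w₁ * χ^2 / |α₂| :=
    lk_root hk hδ0 (by positivity) (hH₁ ▸ hδ.2.trans_le (min_le_left _ _))
  have hD2 : δ^(2*k) < min (w₀ / (h * L)) (w₂ / L) :=
    lk_root hk hδ0 (by positivity) (hH₂ ▸ hδ.2.trans_le (min_le_right _ _))
  have hD : |α₂| * δ^(2*k) ≤ w₁ * χ^2 := by
    rw [lt_div_iff₀ hα] at hD1
    linarith
  have hc0 : 0 < c := by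
    rw [lt_min_iff, lt_div_iff₀ (by positivity), lt_div_iff₀ hLpos] at hD2
    rw [hc, lt_min_iff]
    constructor <;> linarith [hD2.1, hD2.2]
  have hc1 : c ≤ w₀ - h * (|α₂| * |α₁ + α₂|) * δ^(2*k) := by
    rw [← hL, hc]; exact min_le_left _ _
  have hc2 : c ≤ w₂ - (|α₂| * |α₁ + α₂|) * δ^(2*k) := by
    rw [← hL, hc]; exact min_le_right _ _
  have hb1 : 1 + |α₂| * h ≤ b := hb ▸ le_max_left _ _
  have hb2 : (|α₂| * (1 + |α₂| * h) * δ ^ (2*k) + w₁ + h * w₂) * δ ^ (2*k) ≤ b :=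
    hb ▸ le_max_right _ _
  have hbpos : 0 < b := by
    have : 0 ≤ |α₂| * h := by positivity
    linarith
  have hβ0 : 0 ≤ β := by rw [hβ]; positivity
  have hN0 : 0 ≤ N := by rw [hN]; exact Real.iSup_nonneg fun _ => abs_nonneg _
  have hφN : ∀ θ ∈ Icc (-h) (0:ℝ), |φ θ| ≤ N := by
    intro θ hθ
    have hbdd : BddAbove (Set.range fun θ : Icc (-h) (0:ℝ) => |φ θ.1|) := by
      have := (isCompact_Icc.image_of_continuousOn hφc.abs).bddAbove
      rwa [Set.image_eq_range] at this
    rw [hN]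
    exact le_ciSup hbdd ⟨θ, hθ⟩
  have hΔδ : Δ < δ := by
    have h1 : 0 ≤ β * Δ ^ (2*k+1+1) := by positivity
    have h2 : a₁ * δ^2 < 1 * δ^2 := by
      have : 0 < χ^2 * h * |α₂| := by positivity
      apply mul_lt_mul_of_pos_right _ (by positivity)
      linarith
    exact lt_of_pow_lt_pow_left₀ 2 hδ0.le (by linarith)
  set g := 1 + β * Δ ^ (2*k) with hg
  have hg0 : 0 < g := by positivity
  -- extend `x` continuously to the left
  set y : ℝ → ℝ := fun s => x (max s (-h)) with hy
  have hyx : ∀ s ≥ -h, y s = x s := fun s hs => by simp only [hy, max_eq_left hs]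
  have hyc : Continuous y :=
    hxc.comp_continuous (by fun_prop) (fun s => Set.mem_Ici.2 (le_max_right _ _))
  have hyd : ∀ t > 0, HasDerivAt y (α₁ * y t ^ (2*k+1) + α₂ * y (t-h) ^ (2*k+1)) t := by
    intro t ht
    rw [hyx t (by linarith), hyx (t-h) (by linarith)]
    refine (hxd t ht).congr_of_eventuallyEq ?_
    filter_upwards [lt_mem_nhds (show -h < t by linarith)] with s hs
    exact hyx s hs.le
  have hyb : ∀ s ∈ Icc (-h) 0, |y s| ≤ N := fun s hs => by
    rw [hyx s hs.1, hxφ s hs]; exact hφN s hs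
  have hstart := lkV_start (a := α₂) (k := k) (δ := δ) hh hyc hw₁ hw₂ hN0
    (hφΔ.trans hΔδ).le hyb
  rw [← hβ] at hstart
  have hV1 : lkV h α₂ w₁ w₂ k y 0 < a₁ * δ^2 := by
    rw [← hΔ]
    refine hstart.trans_lt ?_
    have h1 : N^2 < Δ^2 := by gcongr
    have h2 : β * N^(2*k+2) ≤ β * Δ^(2*k+2) := by gcongr
    have : 2*k+1+1 = 2*k+2 := by ring
    rw [this]
    linarith
  have hV : lkV h α₂ w₁ w₂ k y 0 ≤ g * N^2 := by
    refine hstart.trans ?_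
    have h1 : β * N^(2*k) * N^2 ≤ β * Δ^(2*k) * N^2 := by gcongr
    have h2 : β * N^(2*k+2) = β * N^(2*k) * N^2 := by ring
    rw [h2, hg]; linarith
  have core := lk_core (V := g * N^2) hh hk hyc hstab hyd hw₁ hw₂ (by rw [hw₀, hw]) hχ0 hN0
    (hφΔ.trans hΔδ) hyb hD hb1 hb2 hc0 hc1 hc2 ha₁ ha₁pos hV1 hV
  intro t ht
  have hcore := core t ht
  rw [hyx t (by linarith)] at hcore
  -- compare the constants
  have hc2eq : c₂ = c * (2 * k) / b * (g / (2 * b * (1+h)))^k := by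
    rw [hc₂, show (2 * (k:ℝ)) / 2 = k by ring, Real.rpow_natCast]
  have hc2nn : 0 ≤ c₂ := by rw [hc2eq]; positivity
  have h2k : (2:ℝ) ≤ 2^k := by
    calc (2:ℝ) = 2^1 := by norm_num
      _ ≤ 2^k := pow_le_pow_right₀ (by norm_num) (by omega)
  have hc2le : c₂ * N^(2*k) ≤ k * (c / (b^(k+1) * (1+h)^k)) * (g * N^2)^k := by
    have e1 : c₂ * N^(2*k) = (2 / 2^k) * (k * (c / (b^(k+1) * (1+h)^k)) * (g * N^2)^k) := by
      rw [hc2eq, div_pow, mul_pow, mul_pow, mul_pow, ← pow_mul]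
      field_simp
      ring
    rw [e1]
    have : (2:ℝ) / 2^k ≤ 1 := by rw [div_le_one (by positivity)]; exact h2k
    exact mul_le_of_le_one_left (by positivity) this
  set Q := 1 + c₂ * N^(2*k) * t with hQ
  have hQ1 : 1 ≤ Q := by
    have : 0 ≤ c₂ * N^(2*k) * t := by positivity
    linarith
  have hQ0 : 0 < Q := by linarith
  have hfin : (a₁ * x t ^ 2)^k * Q ≤ (g * N^2)^k := by
    refine le_trans ?_ hcore
    rw [hQ]
    gcongr
  have hc₁0 : 0 ≤ c₁ := by rw [hc₁]; positivity
  have hc₁sq : c₁^2 = g / a₁ := by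
    rw [hc₁, ← Real.rpow_natCast, ← Real.rpow_mul (by positivity)]
    norm_num
  have hR : (Q ^ (-(1 / (2 * (k:ℝ)))))^(2*k) = Q⁻¹ := by
    rw [← Real.rpow_natCast, ← Real.rpow_mul hQ0.le]
    have : -(1 / (2 * (k:ℝ))) * ((2*k : ℕ):ℝ) = -1 := by push_cast; field_simp
    rw [this, Real.rpow_neg_one]
  refine le_of_pow_le_pow_left₀ (show 2*k ≠ 0 by omega) (by positivity) ?_
  rw [mul_pow, hR, mul_pow, pow_mul c₁, hc₁sq, pow_mul, sq_abs, div_pow, ← div_eq_mul_inv,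
    le_div_iff₀ hQ0, div_mul_eq_mul_div, le_div_iff₀ (by positivity)]
  rw [mul_pow, mul_pow, ← pow_mul N] at hfin
  linarith
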